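/- Well-balancing of the fully discrete 1D scheme: suppose the discrete initial data satisfy u_σ⁰ = 0 for all interfaces and p_L⁰ - p_K⁰ + g (h⁰θ⁰)_σ (b_L - b_K) = 0 for every interface σ = K|L, where p_K = (g/2) h_K² θ_K. Then the explicit update h_K¹ = h_K⁰ - (δt/|K|) Σ_σ h_σ⁰ v_{σ,K}⁰, (hθ)_K¹ = (hθ)_K⁰ - (δt/|K|) Σ_σ (h⁰θ⁰)_σ v_{σ,K}⁰, and the momentum update with stabilised velocity v⁰ = u⁰ - δu⁰ where δu_σ⁰ = η_σ δt (( p_L⁰ - p_K⁰)/|D_σ| + g(h⁰θ⁰)_σ (b_L - b_K)/|D_σ|), yields (h¹, u¹, θ¹) = (h⁰, u⁰, θ⁰). -/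

import Mathlib

/-- Well-balancing of the fully discrete 1D scheme: if the initial velocity
vanishes and the discrete hydrostatic balance
`p_L - p_K + g (hθ)_σ (b_L - b_K) = 0` holds at every interior interface,
then one step of the explicit scheme leaves the solution unchanged.
Cells are `0,…,n-1`, interfaces `0,…,n` (with `0` and `n` being boundary
interfaces where the stabilised velocity vanishes); the interior interface `i`
separates cells `i-1` and `i`. -/
theorem well_balancing_1d
    (n : ℕ) (g δt : ℝ) (hg : 0 < g) (hδt : 0 < δt)
    (vol d : ℕ → ℝ)                -- primal and dual cell sizes
    (h θ b : ℕ → ℝ)                -- cell values at time 0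
    (u : ℕ → ℝ)                    -- interface velocities at time 0
    (η hσ hθσ : ℕ → ℝ)             -- stabilisation parameter, interface values
    (δu v uup : ℕ → ℝ)             -- stabilisation, stabilised and upwind velocities
    (hD hD1 : ℕ → ℝ)               -- dual water heights at times 0 and 1
    (h1 hθ1 u1 θ1 : ℕ → ℝ)         -- updated unknowns
    (hu0 : ∀ i ≤ n, u i = 0)
    (hbal : ∀ i, 0 < i → i < n →
      g / 2 * (h i) ^ 2 * θ i - g / 2 * (h (i - 1)) ^ 2 * θ (i - 1)
        + g * hθσ i * (b i - b (i - 1)) = 0)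
    (hδu : ∀ i, 0 < i → i < n →
      δu i = η i * δt *
        ((g / 2 * (h i) ^ 2 * θ i - g / 2 * (h (i - 1)) ^ 2 * θ (i - 1)) / d i
          + g * hθσ i * (b i - b (i - 1)) / d i))
    (hv : ∀ i, 0 < i → i < n → v i = u i - δu i)
    (hv0 : v 0 = 0) (hvn : v n = 0)
    (hup1 : ∀ k < n,
      h1 k = h k - δt / vol k * (hσ (k + 1) * v (k + 1) - hσ k * v k))
    (hθup1 : ∀ k < n,
      hθ1 k = h k * θ k
        - δt / vol k * (hθσ (k + 1) * v (k + 1) - hθσ k * v k))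
    (hmom : ∀ i, 0 < i → i < n →
      hD1 i * u1 i = hD i * u i
        - δt / d i * ((hσ i * v i) * uup i + (hσ (i + 1) * v (i + 1)) * uup (i + 1))
        - δt * ((g / 2 * (h i) ^ 2 * θ i
            - g / 2 * (h (i - 1)) ^ 2 * θ (i - 1)) / d i
          + g * hθσ i * (b i - b (i - 1)) / d i))
    (hD1pos : ∀ i, 0 < i → i < n → 0 < hD1 i)
    (hθ1def : ∀ k < n, hθ1 k = h1 k * θ1 k) :
    (∀ k < n, h1 k = h k) ∧ (∀ k < n, hθ1 k = h k * θ k) ∧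
    (∀ i, 0 < i → i < n → u1 i = 0) := by
  have hgrad : ∀ i, 0 < i → i < n →
      (g / 2 * (h i) ^ 2 * θ i - g / 2 * (h (i - 1)) ^ 2 * θ (i - 1)) / d i
        + g * hθσ i * (b i - b (i - 1)) / d i = 0 := fun i hi hin => by
    rw [← add_div, hbal i hi hin, zero_div]
  have hv_zero : ∀ i ≤ n, v i = 0 := fun i hin => by
    rcases Nat.eq_zero_or_pos i with rfl | hi
    · exact hv0
    rcases hin.eq_or_lt with rfl | hlt
    · exact hvn
    rw [hv i hi hlt, hu0 i hin, hδu i hi hlt, hgrad i hi hlt, mul_zero, sub_zero]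
  refine ⟨fun k hk => ?_, fun k hk => ?_, fun i hi hin => ?_⟩
  · simp [hup1 k hk, hv_zero k hk.le, hv_zero (k + 1) hk]
  · simp [hθup1 k hk, hv_zero k hk.le, hv_zero (k + 1) hk]
  · have hmul : hD1 i * u1 i = 0 := by
      rw [hmom i hi hin, hgrad i hi hin, hu0 i hin.le, hv_zero i hin.le, hv_zero (i + 1) hin]
      ring
    exact (mul_eq_zero.mp hmul).resolve_left (hD1pos i hi hin).ne'
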